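/- arXiv:2011.13701 — 6 statements merged into one kernel-verified Lean document; each statement's English description precedes it below -/
import Mathlib

section
/- For every natural number n and every real number t with t ≠ -1, one has ∑_{k=0}^{n} l(n,k) · t^k = (1/(1+t)) · ∑_{j=0}^{n} (-1)^j · (D_j / j!) · (t/(1+t))^{n-j} · (1 + t^{j+1}). -/
open Finset

/-- The Leibnitz numbers `l(n,k) = 1/((n+1) * C(n,k))`. -/
noncomputable def leibnitz (n k : ℕ) : ℝ := 1 / (((n : ℝ) + 1) * (n.choose k))

/-- The Daehee numbers `D_n = (-1)^n * n! / (n+1)`. -/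
noncomputable def daehee (n : ℕ) : ℝ := (-1) ^ n * (n.factorial : ℝ) / ((n : ℝ) + 1)

theorem leibnitz_succ_left {n k : ℕ} (hk : k ≤ n) :
    leibnitz (n + 1) k = ((n : ℝ) + 1 - k) / (((n : ℝ) + 2) * (n + 1) * n.choose k) := by
  have h : ((n.choose k : ℕ) : ℝ) * (n + 1) = (n + 1).choose k * ((n : ℝ) + 1 - k) := by
    have h' := Nat.choose_mul_succ_eq n k
    have e := congrArg (Nat.cast (R := ℝ)) h'
    rw [Nat.cast_mul, Nat.cast_mul, Nat.cast_sub (by omega)] at e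
    push_cast at e
    exact e
  have h₀ : (n.choose k : ℝ) ≠ 0 := by exact_mod_cast (Nat.choose_pos hk).ne'
  have h₁ : ((n + 1).choose k : ℝ) ≠ 0 := by
    exact_mod_cast (Nat.choose_pos (hk.trans n.le_succ)).ne'
  have h₂ : (n : ℝ) + 1 ≠ 0 := by positivity
  have h₃ : (n : ℝ) + 2 ≠ 0 := by positivity
  have h₄ : (n : ℝ) + 1 + 1 ≠ 0 := by positivity
  unfold leibnitz
  push_cast
  rw [div_eq_div_iff (by simp [*]) (by simp [*])]
  linear_combination ((n : ℝ) + 2) * h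

theorem leibnitz_succ_succ {n k : ℕ} (hk : k ≤ n) :
    leibnitz (n + 1) (k + 1) = ((k : ℝ) + 1) / (((n : ℝ) + 2) * (n + 1) * n.choose k) := by
  have h : ((n : ℝ) + 1) * n.choose k = (n + 1).choose (k + 1) * ((k : ℝ) + 1) := by
    exact_mod_cast Nat.add_one_mul_choose_eq n k
  have h₀ : (n.choose k : ℝ) ≠ 0 := by exact_mod_cast (Nat.choose_pos hk).ne'
  have h₁ : ((n + 1).choose (k + 1) : ℝ) ≠ 0 := by
    exact_mod_cast (Nat.choose_pos (Nat.succ_le_succ hk)).ne'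
  have h₂ : (n : ℝ) + 1 ≠ 0 := by positivity
  have h₃ : (n : ℝ) + 2 ≠ 0 := by positivity
  have h₄ : (n : ℝ) + 1 + 1 ≠ 0 := by positivity
  unfold leibnitz
  push_cast
  rw [div_eq_div_iff (by simp [*]) (by simp [*])]
  linear_combination ((n : ℝ) + 2) * h

/-- The triangle rule of the Leibniz harmonic triangle. -/
theorem leibnitz_add_leibnitz_succ {n k : ℕ} (hk : k ≤ n) :
    leibnitz (n + 1) k + leibnitz (n + 1) (k + 1) = leibnitz n k := by
  have h₀ : (n.choose k : ℝ) ≠ 0 := by exact_mod_cast (Nat.choose_pos hk).ne'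
  rw [leibnitz_succ_left hk, leibnitz_succ_succ hk, leibnitz]
  field_simp
  ring

theorem one_add_mul_sum_leibnitz_succ (n : ℕ) (t : ℝ) :
    (1 + t) * ∑ k ∈ range (n + 2), leibnitz (n + 1) k * t ^ k =
      t * ∑ k ∈ range (n + 1), leibnitz n k * t ^ k + (1 + t ^ (n + 2)) / ((n : ℝ) + 2) := by
  have h : t * ∑ k ∈ range (n + 1), leibnitz n k * t ^ k =
      (∑ k ∈ range (n + 1), leibnitz (n + 1) (k + 1) * t ^ (k + 1)) +
        t * ∑ k ∈ range (n + 1), leibnitz (n + 1) k * t ^ k := by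
    rw [mul_sum, mul_sum, ← sum_add_distrib]
    refine sum_congr rfl fun k hk => ?_
    rw [← leibnitz_add_leibnitz_succ (mem_range_succ_iff.mp hk)]
    ring
  have h₀ : leibnitz (n + 1) 0 = 1 / ((n : ℝ) + 2) := by
    simp [leibnitz, add_assoc, one_add_one_eq_two]
  have h₁ : leibnitz (n + 1) (n + 1) = 1 / ((n : ℝ) + 2) := by
    simp [leibnitz, add_assoc, one_add_one_eq_two]
  rw [h, add_mul, one_mul]
  nth_rewrite 1 [sum_range_succ']
  rw [sum_range_succ _ (n + 1), h₀, h₁]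
  ring

theorem neg_one_pow_mul_daehee_div_factorial (j : ℕ) :
    (-1) ^ j * (daehee j / (j.factorial : ℝ)) = 1 / ((j : ℝ) + 1) := by
  have h : (j.factorial : ℝ) ≠ 0 := by exact_mod_cast j.factorial_ne_zero
  have h' : ((-1 : ℝ) ^ j) * (-1) ^ j = 1 := by rw [← mul_pow]; simp
  unfold daehee
  field_simp
  rw [sq, h']

theorem stmt2 (n : ℕ) (t : ℝ) (ht : t ≠ -1) :
    ∑ k ∈ range (n + 1), leibnitz n k * t ^ k =
      (1 / (1 + t)) * ∑ j ∈ range (n + 1),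
        (-1) ^ j * (daehee j / (j.factorial : ℝ)) * (t / (1 + t)) ^ (n - j) *
          (1 + t ^ (j + 1)) := by
  have ht' : 1 + t ≠ 0 := fun h => ht (by linarith)
  simp only [neg_one_pow_mul_daehee_div_factorial]
  induction n with
  | zero =>
    simp [leibnitz, ht']
  | succ n ih =>
    have hs : ∑ j ∈ range (n + 1),
        1 / ((j : ℝ) + 1) * (t / (1 + t)) ^ (n + 1 - j) * (1 + t ^ (j + 1)) =
        t / (1 + t) * ∑ j ∈ range (n + 1),
          1 / ((j : ℝ) + 1) * (t / (1 + t)) ^ (n - j) * (1 + t ^ (j + 1)) := by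
      rw [mul_sum]
      refine sum_congr rfl fun j hj => ?_
      rw [Nat.succ_sub (mem_range_succ_iff.mp hj), pow_succ]
      ring
    apply mul_left_cancel₀ ht'
    rw [one_add_mul_sum_leibnitz_succ, ih, sum_range_succ _ (n + 1), hs, Nat.sub_self]
    have h₂ : (n : ℝ) + 2 ≠ 0 := by positivity
    have h₃ : ((n + 1 : ℕ) : ℝ) + 1 = n + 2 := by push_cast; ring
    rw [h₃]
    field_simp
end

section
/- For every natural number n, one has ∑_{k=0}^{n} 1/((n+1) · C(n,k)) = ∑_{j=0}^{n} (-1)^{n-j} · Ch_{n-j} / ((j+1) · (n-j)!). -/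
open Finset

/-- The Changhee numbers `Ch_n = (-1)^n * n! / 2^n`. -/
noncomputable def changhee (n : ℕ) : ℝ := (-1) ^ n * (n.factorial : ℝ) / 2 ^ n

theorem neg_one_pow_mul_changhee_div_factorial (m : ℕ) (x : ℝ) :
    (-1) ^ m * changhee m / (x * (m.factorial : ℝ)) = 1 / (x * 2 ^ m) := by
  have hm : (m.factorial : ℝ) ≠ 0 := by exact_mod_cast m.factorial_ne_zero
  have hs : ((-1 : ℝ) ^ m) * (-1) ^ m = 1 := by rw [← mul_pow]; norm_num
  have h : (-1) ^ m * changhee m = (m.factorial : ℝ) / 2 ^ m := by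
    rw [changhee, mul_div_assoc, ← mul_assoc, hs, one_mul]
  rw [h]
  field_simp

/-- The Pascal-type recurrence of the Leibniz harmonic triangle. -/
theorem one_div_succ_mul_choose_add {n k : ℕ} (hk : k ≤ n) :
    1 / (((n + 1 : ℕ) + 1 : ℝ) * ((n + 1).choose k)) +
      1 / (((n + 1 : ℕ) + 1 : ℝ) * ((n + 1).choose (k + 1))) =
      1 / (((n : ℝ) + 1) * (n.choose k)) := by
  have hc : (0 : ℝ) < n.choose k := by exact_mod_cast Nat.choose_pos hk
  have h₁ : (0 : ℝ) < (n + 1).choose k := by exact_mod_cast Nat.choose_pos (by omega)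
  have h₂ : (0 : ℝ) < (n + 1).choose (k + 1) := by
    exact_mod_cast Nat.choose_pos (by omega)
  have hk' : (0 : ℝ) < (n : ℝ) + 1 - k := by
    have : (k : ℝ) ≤ n := by exact_mod_cast hk
    linarith
  have e₁ : ((n + 1).choose k : ℝ) = n.choose k * (n + 1) / (n + 1 - k) := by
    have := congrArg (Nat.cast (R := ℝ)) (Nat.choose_mul_succ_eq n k)
    rw [eq_div_iff hk'.ne']
    push_cast [Nat.cast_sub (show k ≤ n + 1 by omega)] at this
    exact this.symm
  have e₂ : ((n + 1).choose (k + 1) : ℝ) = n.choose k * (n + 1) / (k + 1) := by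
    have := congrArg (Nat.cast (R := ℝ)) (Nat.add_one_mul_choose_eq n k)
    rw [eq_div_iff (by positivity)]
    push_cast at this
    linarith
  rw [e₁, e₂]
  push_cast
  field_simp
  ring

theorem sum_one_div_succ_mul_choose_succ (n : ℕ) :
    ∑ k ∈ range (n + 1 + 1), 1 / (((n + 1 : ℕ) + 1 : ℝ) * ((n + 1).choose k)) =
      (∑ k ∈ range (n + 1), 1 / (((n : ℝ) + 1) * (n.choose k))) / 2 +
        1 / ((n + 1 : ℕ) + 1 : ℝ) := by
  have h := sum_congr rfl fun k (hk : k ∈ range (n + 1)) =>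
    one_div_succ_mul_choose_add (Nat.lt_succ_iff.mp (mem_range.mp hk))
  rw [sum_add_distrib] at h
  have h₁ := sum_range_succ
    (fun k => 1 / (((n + 1 : ℕ) + 1 : ℝ) * ((n + 1).choose k))) (n + 1)
  have h₂ := sum_range_succ'
    (fun k => 1 / (((n + 1 : ℕ) + 1 : ℝ) * ((n + 1).choose k))) (n + 1)
  simp only [Nat.choose_self, Nat.choose_zero_right, Nat.cast_one, mul_one] at h₁ h₂
  linarith

theorem sum_one_div_succ_mul_choose (n : ℕ) :
    ∑ k ∈ range (n + 1), 1 / (((n : ℝ) + 1) * (n.choose k)) =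
      ∑ j ∈ range (n + 1), 1 / (((j : ℝ) + 1) * 2 ^ (n - j)) := by
  induction n with
  | zero => simp
  | succ n ih =>
    rw [sum_one_div_succ_mul_choose_succ, ih, sum_range_succ _ (n + 1), sum_div]
    congr 1
    · refine sum_congr rfl fun j hj => ?_
      rw [Nat.succ_sub (Nat.lt_succ_iff.mp (mem_range.mp hj)), pow_succ, div_div, mul_assoc]
    · simp

theorem stmt5 (n : ℕ) :
    ∑ k ∈ range (n + 1), 1 / (((n : ℝ) + 1) * (n.choose k)) =
      ∑ j ∈ range (n + 1),
        (-1) ^ (n - j) * changhee (n - j) / (((j : ℝ) + 1) * ((n - j).factorial : ℝ)) := by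
  simp only [neg_one_pow_mul_changhee_div_factorial]
  exact sum_one_div_succ_mul_choose n
end

section
/- For every natural number n ≥ 1, one has ∑_{k=0}^{n} l(n,k) - (1/2) · ∑_{k=0}^{n-1} l(n-1,k) = (-1)^n · D_n / n!. -/
open Finset

/-- Leibnitz's harmonic triangle: each entry is the sum of the two entries below it. -/
theorem leibnitz_eq_add {m k : ℕ} (hk : k ≤ m) :
    leibnitz m k = leibnitz (m + 1) k + leibnitz (m + 1) (k + 1) := by
  obtain ⟨j, rfl⟩ := Nat.exists_eq_add_of_le hk
  have ha : ((k + j).choose k : ℝ) ≠ 0 :=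
    Nat.cast_ne_zero.mpr (Nat.choose_pos (by omega)).ne'
  have hb : ((k + j + 1).choose k : ℝ) = ((k : ℝ) + j + 1) * (k + j).choose k / (j + 1) := by
    have h := Nat.choose_mul_succ_eq (k + j) k
    rw [show k + j + 1 - k = j + 1 by omega] at h
    rw [eq_div_iff (by positivity), mul_comm _ ((k + j).choose k : ℝ)]
    exact_mod_cast h.symm
  have hc : ((k + j + 1).choose (k + 1) : ℝ) =
      ((k : ℝ) + j + 1) * (k + j).choose k / (k + 1) := by
    rw [eq_div_iff (by positivity)]
    exact_mod_cast (Nat.add_one_mul_choose_eq (k + j) k).symm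
  have hj : (j : ℝ) + 1 ≠ 0 := by positivity
  have hk' : (k : ℝ) + 1 ≠ 0 := by positivity
  have h1 : (k : ℝ) + j + 1 ≠ 0 := by positivity
  have h2 : (k : ℝ) + j + 1 + 1 ≠ 0 := by positivity
  unfold leibnitz
  rw [hb, hc]
  push_cast
  field_simp
  ring

theorem stmt7 (n : ℕ) (hn : 1 ≤ n) :
    ∑ k ∈ range (n + 1), leibnitz n k -
        (1 / 2) * ∑ k ∈ range n, leibnitz (n - 1) k =
      (-1) ^ n * daehee n / (n.factorial : ℝ) := by
  obtain ⟨m, rfl⟩ := Nat.exists_eq_add_of_le' hn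
  have hrec : ∑ k ∈ range (m + 1), leibnitz m k =
      ∑ k ∈ range (m + 1), leibnitz (m + 1) k +
        ∑ k ∈ range (m + 1), leibnitz (m + 1) (k + 1) := by
    rw [← sum_add_distrib]
    exact sum_congr rfl fun k hk => leibnitz_eq_add (by simpa [Nat.lt_succ_iff] using hk)
  have hlast := sum_range_succ (leibnitz (m + 1)) (m + 1)
  have hfirst := sum_range_succ' (leibnitz (m + 1)) (m + 1)
  have h0 : leibnitz (m + 1) 0 = 1 / ((m : ℝ) + 1 + 1) := by simp [leibnitz]
  have hm : leibnitz (m + 1) (m + 1) = 1 / ((m : ℝ) + 1 + 1) := by simp [leibnitz]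
  have hr : (-1) ^ (m + 1) * daehee (m + 1) / ((m + 1).factorial : ℝ) =
      1 / ((m : ℝ) + 1 + 1) := by
    have hf : ((m + 1).factorial : ℝ) ≠ 0 := Nat.cast_ne_zero.mpr (Nat.factorial_ne_zero _)
    have hs : ((-1 : ℝ) ^ (m + 1)) * (-1) ^ (m + 1) = 1 := by
      rw [← mul_pow]; norm_num
    unfold daehee
    rw [← mul_div_assoc, ← mul_assoc, hs, one_mul, div_div, mul_comm (_ + 1), ← div_div, div_self hf]
    push_cast
    rfl
  rw [hr, Nat.add_sub_cancel]
  linarith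
end

section
/- For every natural number n ≥ 1, one has ∑_{k=0}^{n} l(n,k) - (1/2) · ∑_{k=0}^{n-1} l(n-1,k) = 1/(n+1). -/
open Finset

/-- The Leibnitz numbers form a harmonic triangle: each is the sum of the two below it. -/
lemma leibnitz_succ_add_leibnitz_succ_succ {m k : ℕ} (hk : k ≤ m) :
    leibnitz (m + 1) k + leibnitz (m + 1) (k + 1) = leibnitz m k := by
  have hleft : (m.choose k : ℝ) * (m + 1) = (m + 1).choose k * (m + 1 - k) := by
    have h := congrArg (Nat.cast (R := ℝ)) (Nat.choose_mul_succ_eq m k)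
    rw [Nat.cast_mul, Nat.cast_mul, Nat.cast_sub (by lia)] at h
    exact_mod_cast h
  have hright : ((m : ℝ) + 1) * m.choose k = (m + 1).choose (k + 1) * (k + 1) :=
    mod_cast Nat.add_one_mul_choose_eq m k
  have ha : (0 : ℝ) < m.choose k := mod_cast Nat.choose_pos hk
  have hb : (0 : ℝ) < (m + 1).choose k := mod_cast Nat.choose_pos (by lia)
  have hc : (0 : ℝ) < (m + 1).choose (k + 1) := mod_cast Nat.choose_pos (by lia)
  have hm : (0 : ℝ) < (m : ℝ) + 1 := by positivity
  have hinv_left : 1 / ((m + 1).choose k : ℝ) = (m + 1 - k) / ((m + 1) * m.choose k) := by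
    rw [div_eq_div_iff hb.ne' (by positivity)]
    linarith
  have hinv_right : 1 / ((m + 1).choose (k + 1) : ℝ) = (k + 1) / ((m + 1) * m.choose k) := by
    rw [div_eq_div_iff hc.ne' (by positivity)]
    linarith
  unfold leibnitz
  rw [← one_div_mul_one_div, ← one_div_mul_one_div (_ + 1) ((m + 1).choose (k + 1) : ℝ),
    hinv_left, hinv_right]
  push_cast
  field_simp
  ring

theorem stmt8 (n : ℕ) (hn : 1 ≤ n) :
    ∑ k ∈ range (n + 1), leibnitz n k -
        (1 / 2) * ∑ k ∈ range n, leibnitz (n - 1) k =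
      1 / ((n : ℝ) + 1) := by
  obtain ⟨m, rfl⟩ := Nat.exists_eq_add_of_le' hn
  have hsum : ∑ k ∈ range (m + 1), leibnitz m k =
      ∑ k ∈ range (m + 1), leibnitz (m + 1) k +
        ∑ k ∈ range (m + 1), leibnitz (m + 1) (k + 1) := by
    rw [← sum_add_distrib]
    exact sum_congr rfl fun k hk =>
      (leibnitz_succ_add_leibnitz_succ_succ (by simpa [Nat.lt_succ_iff] using hk)).symm
  have hlast := sum_range_succ (leibnitz (m + 1)) (m + 1)
  have hfirst := sum_range_succ' (leibnitz (m + 1)) (m + 1)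
  have h_zero : leibnitz (m + 1) 0 = 1 / (((m + 1 : ℕ) : ℝ) + 1) := by simp [leibnitz]
  have h_self : leibnitz (m + 1) (m + 1) = 1 / (((m + 1 : ℕ) : ℝ) + 1) := by simp [leibnitz]
  rw [Nat.add_sub_cancel, hsum]
  linarith
end

section
/- For every natural number n, one has ∑_{k=0}^{n} l(n,k) = (1/n!) · ∑_{k=0}^{n} ∑_{j=0}^{n-k} (-1)^j · C(n,k) · C(n-k,j) · C(k,j) · (j! · (n-j)! / (n-j+1)). -/
open Finset

lemma fwdDiff_iter_choose_real (j k : ℕ) :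
    (fwdDiff 1)^[k] (fun x : ℕ ↦ (x.choose (k + j) : ℝ)) = fun x ↦ (x.choose j : ℝ) := by
  induction k generalizing j with
  | zero => simp
  | succ k ih =>
    rw [Function.iterate_succ_apply', show k + 1 + j = k + (j + 1) by ring, ih]
    ext x
    simp [fwdDiff, Nat.choose_succ_succ']

lemma choose_succ_div_succ (m y : ℕ) :
    (y.choose (m + 1) : ℝ) / (y + 1) =
      (1 / ((m : ℝ) + 1)) * y.choose m - y.choose m / (y + 1) := by
  have h : ((y + 1).choose (m + 1) : ℝ) * (m + 1) = (y + 1) * y.choose m := by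
    exact_mod_cast (Nat.add_one_mul_choose_eq y m).symm
  rw [Nat.choose_succ_succ'] at h
  push_cast at h
  field_simp
  linarith

lemma fwdDiff_iter_choose_div_succ (m y : ℕ) :
    (fwdDiff 1)^[m] (fun x : ℕ ↦ (x.choose m : ℝ) / (x + 1)) y =
      (m.factorial : ℝ) * y.factorial / (y + m + 1).factorial := by
  induction m generalizing y with
  | zero =>
    have : (y.factorial : ℝ) ≠ 0 := by positivity
    simp [Nat.factorial_succ]
    field_simp
  | succ m ih =>
    have hf : (fun x : ℕ ↦ (x.choose (m + 1) : ℝ) / (x + 1)) =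
        (1 / ((m : ℝ) + 1)) • (fun x : ℕ ↦ (x.choose m : ℝ)) +
          (-1 : ℝ) • (fun x : ℕ ↦ (x.choose m : ℝ) / (x + 1)) := by
      ext x
      simp only [Pi.add_apply, Pi.smul_apply, smul_eq_mul]
      rw [choose_succ_div_succ]
      ring
    have h_choose : (fwdDiff 1)^[m] (fun x : ℕ ↦ (x.choose m : ℝ)) = fun _ ↦ 1 := by
      simpa using fwdDiff_iter_choose_real 0 m
    rw [hf, fwdDiff_iter_add, fwdDiff_iter_const_smul, fwdDiff_iter_const_smul,
      Function.iterate_succ_apply', Function.iterate_succ_apply', h_choose]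
    simp only [Pi.add_apply, Pi.smul_apply, smul_eq_mul, fwdDiff, ih]
    rw [show y + 1 + m + 1 = y + m + 1 + 1 by ring, show y + (m + 1) + 1 = y + m + 1 + 1 by ring,
      Nat.factorial_succ (y + m + 1), Nat.factorial_succ y, Nat.factorial_succ m]
    have : ((y + m + 1).factorial : ℝ) ≠ 0 := by positivity
    push_cast
    field_simp
    ring

lemma sum_neg_one_pow_mul_choose_mul_choose_div (m k : ℕ) :
    ∑ j ∈ range (m + 1),
        (-1 : ℝ) ^ j * m.choose j * (((m + k - j).choose m : ℝ) / (((m + k - j : ℕ) : ℝ) + 1)) =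
      (m.factorial : ℝ) * k.factorial / (m + k + 1).factorial := by
  rw [add_comm m k, ← fwdDiff_iter_choose_div_succ, fwdDiff_iter_eq_sum_shift,
    ← sum_range_reflect]
  refine sum_congr rfl fun i hi ↦ ?_
  have him : i ≤ m := Nat.lt_succ_iff.mp (mem_range.mp hi)
  rw [show m + 1 - 1 - i = m - i by omega, show k + m - (m - i) = k + i by omega,
    Nat.choose_symm him]
  simp

lemma choose_mul_factorial_mul_factorial_add (k i j : ℕ) :
    k.choose j * j.factorial * (k + i).factorial =
      k.factorial * (i + j).factorial * (k + i).choose (i + j) := by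
  rcases le_or_gt j k with h | h
  · apply Nat.eq_of_mul_eq_mul_right (Nat.factorial_pos (k - j))
    have h1 := Nat.choose_mul_factorial_mul_factorial h
    have h2 := Nat.choose_mul_factorial_mul_factorial (show i + j ≤ k + i by omega)
    rw [show k + i - (i + j) = k - j by omega] at h2
    rw [← h1, ← h2]
    ring
  · rw [Nat.choose_eq_zero_of_lt h, Nat.choose_eq_zero_of_lt (show k + i < i + j by omega)]
    simp

lemma leibnitz_add_eq_sum (m k : ℕ) :
    leibnitz (m + k) k =
      (1 / ((m + k).factorial : ℝ)) * ∑ j ∈ range (m + 1),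
        (-1) ^ j * ((m + k).choose k : ℝ) * (m.choose j : ℝ) * (k.choose j : ℝ) *
          ((j.factorial : ℝ) * ((m + k - j).factorial : ℝ) / (((m + k - j : ℕ) : ℝ) + 1)) := by
  have hsum : ∑ j ∈ range (m + 1),
        (-1) ^ j * ((m + k).choose k : ℝ) * (m.choose j : ℝ) * (k.choose j : ℝ) *
          ((j.factorial : ℝ) * ((m + k - j).factorial : ℝ) / (((m + k - j : ℕ) : ℝ) + 1)) =
      ((m + k).choose k * k.factorial * m.factorial : ℝ) *
        ((m.factorial : ℝ) * k.factorial / (m + k + 1).factorial) := by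
    rw [← sum_neg_one_pow_mul_choose_mul_choose_div, mul_sum]
    refine sum_congr rfl fun j hj ↦ ?_
    obtain ⟨i, rfl⟩ := Nat.exists_eq_add_of_le' (Nat.lt_succ_iff.mp (mem_range.mp hj))
    rw [show i + j + k - j = k + i by omega]
    have h : (k.choose j : ℝ) * j.factorial * (k + i).factorial =
        k.factorial * (i + j).factorial * (k + i).choose (i + j) := by
      exact_mod_cast choose_mul_factorial_mul_factorial_add k i j
    linear_combination
      ((-1) ^ j * ((i + j + k).choose k : ℝ) * (i + j).choose j / (((k + i : ℕ) : ℝ) + 1)) * h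
  have hn : ((m + k).choose k * k.factorial * m.factorial : ℝ) = (m + k).factorial := by
    have := Nat.choose_mul_factorial_mul_factorial (Nat.le_add_left k m)
    rw [Nat.add_sub_cancel] at this
    exact_mod_cast this
  have hc : ((m + k).choose k : ℝ) ≠ 0 := by
    exact_mod_cast (Nat.choose_pos (Nat.le_add_left k m)).ne'
  rw [hsum, hn, leibnitz, Nat.factorial_succ, Nat.cast_mul, ← hn]
  have hk : (k.factorial : ℝ) ≠ 0 := by positivity
  have hm : (m.factorial : ℝ) ≠ 0 := by positivity
  push_cast
  field_simp

theorem stmt14 (n : ℕ) :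
    ∑ k ∈ range (n + 1), leibnitz n k =
      (1 / (n.factorial : ℝ)) * ∑ k ∈ range (n + 1), ∑ j ∈ range (n - k + 1),
        (-1) ^ j * (n.choose k : ℝ) * ((n - k).choose j : ℝ) * (k.choose j : ℝ) *
          ((j.factorial : ℝ) * ((n - j).factorial : ℝ) / (((n - j : ℕ) : ℝ) + 1)) := by
  rw [mul_sum]
  refine sum_congr rfl fun k hk ↦ ?_
  obtain ⟨m, rfl⟩ := Nat.exists_eq_add_of_le' (Nat.lt_succ_iff.mp (mem_range.mp hk))
  rw [Nat.add_sub_cancel]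
  exact leibnitz_add_eq_sum m k
end

section
/- For all real numbers t and u with 0 ≤ t ≤ 1 and 0 < u < 1, the series ∑_{n=0}^{∞} (∑_{k=0}^{n} l(n,k) · t^k) · u^n converges, and its sum equals (log(1-u) + log(1-t·u)) / ((1-u)·(1-t·u) - 1). -/
open Finset

theorem leibnitz_succ_add_leibnitz_succ {n k : ℕ} (h : k ≤ n) :
    leibnitz (n + 1) (k + 1) + leibnitz (n + 1) k = leibnitz n k := by
  have h1 : ((n + 1).choose (k + 1) : ℝ) * (k + 1) = (n + 1) * n.choose k := by
    exact_mod_cast (Nat.add_one_mul_choose_eq n k).symm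
  have h2 : ((n + 1).choose k : ℝ) * (n + 1 - k) = (n + 1) * n.choose k := by
    have := Nat.choose_mul_succ_eq n k
    zify [show k ≤ n + 1 by omega] at this
    have h' : ((n.choose k : ℝ)) * (n + 1) = (n + 1).choose k * (n + 1 - k) := by
      exact_mod_cast this
    linarith
  have p0 : (0 : ℝ) < n.choose k := by exact_mod_cast Nat.choose_pos h
  have p1 : (0 : ℝ) < (n + 1).choose (k + 1) := by
    exact_mod_cast Nat.choose_pos (Nat.succ_le_succ h)
  have p2 : (0 : ℝ) < (n + 1).choose k := by exact_mod_cast Nat.choose_pos (by omega)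
  have e1 : 1 / ((n + 1).choose (k + 1) : ℝ) = (k + 1) / ((n + 1) * n.choose k) := by
    rw [div_eq_div_iff p1.ne' (by positivity)]
    linarith
  have e2 : 1 / ((n + 1).choose k : ℝ) = (n + 1 - k) / ((n + 1) * n.choose k) := by
    rw [div_eq_div_iff p2.ne' (by positivity)]
    linarith
  unfold leibnitz
  push_cast
  rw [← one_div_mul_one_div, ← one_div_mul_one_div, e1, e2]
  have : (n : ℝ) + 1 + 1 ≠ 0 := by positivity
  field_simp
  ring

theorem one_add_mul_sum_leibnitz (n : ℕ) (t : ℝ) :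
    (1 + t) * ∑ k ∈ range (n + 2), leibnitz (n + 1) k * t ^ k =
      t * ∑ k ∈ range (n + 1), leibnitz n k * t ^ k + (1 + t ^ (n + 2)) / (n + 2) := by
  have h : ∑ k ∈ range (n + 1), leibnitz n k * t ^ k =
      ∑ k ∈ range (n + 1), leibnitz (n + 1) (k + 1) * t ^ k +
        ∑ k ∈ range (n + 1), leibnitz (n + 1) k * t ^ k := by
    rw [← sum_add_distrib]
    refine sum_congr rfl fun k hk => ?_
    rw [← leibnitz_succ_add_leibnitz_succ (Nat.lt_succ_iff.mp (mem_range.mp hk)), add_mul]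
  have h' : t * ∑ k ∈ range (n + 1), leibnitz (n + 1) (k + 1) * t ^ k =
      ∑ k ∈ range (n + 1), leibnitz (n + 1) (k + 1) * t ^ (k + 1) := by
    rw [mul_sum]
    exact sum_congr rfl fun k _ => by ring
  have hfirst : leibnitz (n + 1) 0 = 1 / (n + 2) := by
    simp only [leibnitz, Nat.choose_zero_right]
    push_cast
    ring
  have hlast : leibnitz (n + 1) (n + 1) = 1 / (n + 2) := by
    simp only [leibnitz, Nat.choose_self]
    push_cast
    ring
  have hf := sum_range_succ' (fun k => leibnitz (n + 1) k * t ^ k) (n + 1)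
  have hl := sum_range_succ (fun k => leibnitz (n + 1) k * t ^ k) (n + 1)
  rw [hfirst] at hf
  rw [hlast] at hl
  linear_combination hf + t * hl - t * h - h'

theorem leibnitz_nonneg (n k : ℕ) : 0 ≤ leibnitz n k := by
  unfold leibnitz
  positivity

theorem leibnitz_le {n k : ℕ} (h : k ≤ n) : leibnitz n k ≤ 1 / (n + 1) := by
  have : (1 : ℝ) ≤ n.choose k := by exact_mod_cast Nat.choose_pos h
  exact one_div_le_one_div_of_le (by positivity) (le_mul_of_one_le_right (by positivity) this)

theorem sum_leibnitz_mul_pow_le_one (n : ℕ) {t : ℝ} (ht0 : 0 ≤ t) (ht1 : t ≤ 1) :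
    ∑ k ∈ range (n + 1), leibnitz n k * t ^ k ≤ 1 := by
  calc ∑ k ∈ range (n + 1), leibnitz n k * t ^ k
      ≤ ∑ _k ∈ range (n + 1), 1 / ((n : ℝ) + 1) := by
        refine sum_le_sum fun k hk => ?_
        exact (mul_le_of_le_one_right (leibnitz_nonneg n k) (pow_le_one₀ ht0 ht1)).trans
          (leibnitz_le (Nat.lt_succ_iff.mp (mem_range.mp hk)))
    _ = 1 := by
        have : (n : ℝ) + 1 ≠ 0 := by positivity
        simp [this]

theorem summable_sum_leibnitz {t u : ℝ} (ht0 : 0 ≤ t) (ht1 : t ≤ 1) (hu0 : 0 ≤ u) (hu1 : u < 1) :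
    Summable fun n : ℕ => (∑ k ∈ range (n + 1), leibnitz n k * t ^ k) * u ^ n := by
  refine Summable.of_nonneg_of_le (fun n => ?_) (fun n => ?_)
    (summable_geometric_of_lt_one hu0 hu1)
  · exact mul_nonneg (sum_nonneg fun k _ => mul_nonneg (leibnitz_nonneg n k) (pow_nonneg ht0 k))
      (pow_nonneg hu0 n)
  · exact mul_le_of_le_one_left (pow_nonneg hu0 n) (sum_leibnitz_mul_pow_le_one n ht0 ht1)

theorem stmt16 (t u : ℝ) (ht0 : 0 ≤ t) (ht1 : t ≤ 1) (hu0 : 0 < u) (hu1 : u < 1) :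
    HasSum (fun n : ℕ => (∑ k ∈ range (n + 1), leibnitz n k * t ^ k) * u ^ n)
      ((Real.log (1 - u) + Real.log (1 - t * u)) / ((1 - u) * (1 - t * u) - 1)) := by
  obtain ⟨S, hS⟩ := summable_sum_leibnitz ht0 ht1 hu0.le hu1
  have htu0 : 0 ≤ t * u := mul_nonneg ht0 hu0.le
  have htu1 : t * u < 1 := (mul_le_of_le_one_left hu0.le ht1).trans_lt hu1
  have hlog := (Real.hasSum_pow_div_log_of_abs_lt_one (abs_lt.mpr ⟨by linarith, hu1⟩)).add
    (Real.hasSum_pow_div_log_of_abs_lt_one (abs_lt.mpr ⟨by linarith, htu1⟩))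
  have hlog' := (hasSum_nat_add_iff' 1).mpr hlog
  have hS' := (((hasSum_nat_add_iff' 1).mpr hS).mul_left (u * (1 + t))).sub
    (hS.mul_left (t * u ^ 2))
  have key := hS'.unique (hlog'.congr_fun fun n => by
    have := one_add_mul_sum_leibnitz n t
    push_cast
    linear_combination u ^ (n + 2) * this)
  have hden : (1 - u) * (1 - t * u) - 1 ≠ 0 := by nlinarith
  convert hS using 1
  rw [div_eq_iff hden]
  simp [leibnitz] at key
  linear_combination key
end
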